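/- Let (V,g,J) be a pseudo-hermitian vector space of real dimension 2n with n ≥ 2, and let R ∈ K(V) be a Kähler algebraic curvature tensor. Define the bilinear forms Ric := Ric(R), r(x,y) := Ric(Jx,y), the scalar Scal := Scal(R), and the Bochner tensor Boch := R − 1/(2(n+2))·[g⊘Ric + ω⊘r + 2·ω⊙r] + Scal/(8(n+1)(n+2))·[g⊘g + ω⊘ω + 2·ω⊙ω]. Then the following are equivalent: (i) Boch = 0; (ii) there exist a hermitian endomorphism A of V and a real polynomial q of degree ≤ 2 such that R = R_{q,A}; (iii) there exists a hermitian endomorphism B of V such that R = R_{id,B}. -/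

import Mathlib

open Finset Polynomial

noncomputable section

/-- Kulkarni–Nomizu product of two bilinear forms (as 4-tensor):
`(P⊘Q)(x,y,u,v) = P(x,u)Q(y,v) − P(x,v)Q(y,u) + Q(x,u)P(y,v) − Q(x,v)P(y,u)`. -/
def KN4 {V : Type*} [AddCommGroup V] [Module ℝ V] (P Q : V → V → ℝ) (x y u v : V) : ℝ :=
  P x u * Q y v - P x v * Q y u + Q x u * P y v - Q x v * P y u

/-- Symmetric product `(P⊙Q)(x,y,u,v) = P(x,y)Q(u,v) + Q(x,y)P(u,v)`. -/
def SP4 {V : Type*} [AddCommGroup V] [Module ℝ V] (P Q : V → V → ℝ) (x y u v : V) : ℝ :=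
  P x y * Q u v + Q x y * P u v

/-- `R_{A,B} = gA⊘gB + ωA⊘ωB + 2·ωA⊙ωB`, where `gA = g(A·,·)` and `ωA = ω(A·,·)`
with `ω(x,y) = g(Jx,y)`. -/
def RAB {V : Type*} [AddCommGroup V] [Module ℝ V]
    (g : V →ₗ[ℝ] V →ₗ[ℝ] ℝ) (J A B : Module.End ℝ V) (x y u v : V) : ℝ :=
  KN4 (fun a b => g (A a) b) (fun a b => g (B a) b) x y u v
    + KN4 (fun a b => g (J (A a)) b) (fun a b => g (J (B a)) b) x y u v
    + 2 * SP4 (fun a b => g (J (A a)) b) (fun a b => g (J (B a)) b) x y u v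

/-- `R_{q,A} = −(1/8)·Σ_{k} a_k Σ_{r+s=k−1} R_{A^r,A^s}` for a real polynomial
`q(t) = Σ_k a_k t^k`. -/
def RqA {V : Type*} [AddCommGroup V] [Module ℝ V]
    (g : V →ₗ[ℝ] V →ₗ[ℝ] ℝ) (J : Module.End ℝ V) (q : Polynomial ℝ)
    (A : Module.End ℝ V) (x y u v : V) : ℝ :=
  -(1 / 8 : ℝ) * ∑ k ∈ Finset.range (q.natDegree + 1), q.coeff k *
    ∑ r ∈ Finset.range k, RAB g J (A ^ r) (A ^ (k - 1 - r)) x y u v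

/-- The Ricci tensor of a curvature tensor given through its curvature endomorphisms
`Rend u v : y ↦ R(u,v)y`: `Ric(x,y) = tr(z ↦ Rend z x y)`. -/
def ricci {V : Type*} [AddCommGroup V] [Module ℝ V]
    (Rend : V →ₗ[ℝ] V →ₗ[ℝ] V →ₗ[ℝ] V) (x y : V) : ℝ :=
  LinearMap.trace ℝ V ((LinearMap.applyₗ y).comp ((LinearMap.applyₗ x).comp Rend))

lemma eq_of_forall_apply_eq {V : Type*} [AddCommGroup V] [Module ℝ V]
    {g : V →ₗ[ℝ] V →ₗ[ℝ] ℝ} (hgsymm : ∀ x y : V, g x y = g y x)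
    (hgnd : ∀ x : V, (∀ y : V, g x y = 0) → x = 0) {a b : V}
    (h : ∀ w, g w a = g w b) : a = b := by
  refine sub_eq_zero.1 (hgnd _ fun y => ?_)
  rw [hgsymm, map_sub, h, sub_self]

/-- An endomorphism and its adjoint with respect to a nondegenerate symmetric bilinear form
have the same trace. -/
lemma trace_eq_of_adjoint {V : Type*} [AddCommGroup V] [Module ℝ V] [FiniteDimensional ℝ V]
    {g : V →ₗ[ℝ] V →ₗ[ℝ] ℝ} (hgsymm : ∀ x y : V, g x y = g y x)
    (hgnd : ∀ x : V, (∀ y : V, g x y = 0) → x = 0) {S T : Module.End ℝ V}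
    (h : ∀ w z, g w (S z) = g z (T w)) :
    LinearMap.trace ℝ V S = LinearMap.trace ℝ V T := by
  have hinj : Function.Injective g := by
    rw [← LinearMap.ker_eq_bot, LinearMap.ker_eq_bot']
    exact fun x hx => hgnd x fun y => by rw [hx, LinearMap.zero_apply]
  let e : V ≃ₗ[ℝ] Module.Dual ℝ V :=
    LinearMap.linearEquivOfInjective g hinj Subspace.dual_finrank_eq.symm
  rw [← LinearMap.trace_transpose' S, ← LinearMap.trace_conj' T e]
  congr 1
  ext φ z
  obtain ⟨w, rfl⟩ := e.surjective φ
  have he : ∀ a b, e a b = g a b := fun _ _ => rfl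
  rw [LinearEquiv.conj_apply_apply, LinearEquiv.symm_apply_apply, he, hgsymm]
  exact h w z

/-- A skew-adjoint endomorphism is traceless. -/
lemma trace_eq_zero_of_skew {V : Type*} [AddCommGroup V] [Module ℝ V] [FiniteDimensional ℝ V]
    {g : V →ₗ[ℝ] V →ₗ[ℝ] ℝ} (hgsymm : ∀ x y : V, g x y = g y x)
    (hgnd : ∀ x : V, (∀ y : V, g x y = 0) → x = 0) {S : Module.End ℝ V}
    (h : ∀ w z, g w (S z) = -g z (S w)) : LinearMap.trace ℝ V S = 0 := by
  have := trace_eq_of_adjoint hgsymm hgnd (S := S) (T := -S) fun w z => by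
    rw [LinearMap.neg_apply, map_neg, h]
  rw [map_neg] at this
  linarith

section Hermitian

variable {V : Type*} [AddCommGroup V] [Module ℝ V] {g : V →ₗ[ℝ] V →ₗ[ℝ] ℝ}
  {J : Module.End ℝ V}

lemma complexStructure_apply_apply (hJ2 : J * J = -1) (x : V) : J (J x) = -x := by
  simpa using LinearMap.congr_fun hJ2 x

lemma complexStructure_skew (hJ2 : J * J = -1) (hJg : ∀ x y : V, g (J x) (J y) = g x y)
    (x y : V) : g (J x) y = -g x (J y) := by
  rw [← hJg x (J y), complexStructure_apply_apply hJ2, map_neg, neg_neg]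

/-- The Ricci contraction of `R_{id,B}`. -/
lemma trace_of_eq_RAB_one [FiniteDimensional ℝ V] (hgsymm : ∀ x y : V, g x y = g y x)
    (hgnd : ∀ x : V, (∀ y : V, g x y = 0) → x = 0) (hJ2 : J * J = -1)
    (hJg : ∀ x y : V, g (J x) (J y) = g x y) {B : Module.End ℝ V}
    (hB : ∀ x y : V, g (B x) y = g x (B y)) (hBJ : B * J = J * B) {x y : V}
    {T : Module.End ℝ V} (hT : ∀ w z, g w (T z) = RAB g J 1 B w y z x) :
    LinearMap.trace ℝ V T =
      (Module.finrank ℝ V + 4) * g x (B y) + LinearMap.trace ℝ V B * g x y := by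
  have hJJ := complexStructure_apply_apply hJ2
  have hJs := complexStructure_skew hJ2 hJg
  have hc : ∀ a, B (J a) = J (B a) := fun a => LinearMap.congr_fun hBJ a
  have hJ0 : LinearMap.trace ℝ V J = 0 := trace_eq_zero_of_skew hgsymm hgnd fun w z => by
    rw [← hJs, hgsymm]
  have hJB0 : LinearMap.trace ℝ V (J * B) = 0 := trace_eq_zero_of_skew hgsymm hgnd fun w z => by
    rw [Module.End.mul_apply, Module.End.mul_apply, ← hc, ← hB, hgsymm, hJs]
  have hTe : T = g (B y) x • (1 : Module.End ℝ V) - (g (B y)).smulRight x + g y x • B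
      - (g y).smulRight (B x) - g (J (B y)) x • J + (g (J (B y))).smulRight (J x)
      - g (J y) x • (J * B) + (g (J y)).smulRight (J (B x))
      + (2 : ℝ) • ((g (J (B x))).smulRight (J y) + (g (J x)).smulRight (J (B y))) := by
    ext z
    refine eq_of_forall_apply_eq hgsymm hgnd fun w => ?_
    rw [hT]
    simp only [RAB, KN4, SP4, Module.End.one_apply, LinearMap.add_apply, LinearMap.sub_apply,
      LinearMap.smul_apply, LinearMap.smulRight_apply, Module.End.mul_apply, map_add, map_sub,
      map_smul, smul_eq_mul, hJs, hB, hc]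
    rw [hgsymm z (J x), hgsymm z (J (B x)), hJs, hJs, hB, hc]
    ring
  rw [hTe]
  simp only [map_add, map_sub, map_smul, LinearMap.trace_smulRight, LinearMap.trace_one, hJ0, hJB0,
    smul_eq_mul, hJs, hB, hc, hJJ, map_neg]
  rw [hgsymm y x, hgsymm y (B x), hB]
  ring

lemma smul_one_add_smul_commute (a b : ℝ) {A : Module.End ℝ V} (h : A * J = J * A) :
    (a • 1 + b • A) * J = J * (a • 1 + b • A) :=
  ((Commute.one_left J).smul_left a).add_left (Commute.smul_left h b)

lemma RAB_comm (A B : Module.End ℝ V) (x y u v : V) :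
    RAB g J A B x y u v = RAB g J B A x y u v := by
  simp only [RAB, KN4, SP4]
  ring

lemma RAB_one_smul_one_add_smul (a b : ℝ) (A : Module.End ℝ V) (x y u v : V) :
    RAB g J 1 (a • 1 + b • A) x y u v = a * RAB g J 1 1 x y u v + b * RAB g J 1 A x y u v := by
  simp only [RAB, KN4, SP4, Module.End.one_apply, LinearMap.add_apply, LinearMap.smul_apply,
    map_add, map_smul, smul_eq_mul]
  ring

lemma RqA_of_natDegree_le_two {q : Polynomial ℝ} (hq : q.natDegree ≤ 2) (A : Module.End ℝ V)
    (x y u v : V) :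
    RqA g J q A x y u v =
      RAB g J 1 ((-(q.coeff 1) / 8) • 1 + (-(q.coeff 2) / 4) • A) x y u v := by
  rw [RAB_one_smul_one_add_smul, RqA, Finset.sum_subset (s₂ := Finset.range 3)]
  · simp only [Finset.sum_range_succ, Finset.sum_range_zero, pow_zero, pow_one, Nat.sub_self,
      Nat.sub_zero, Nat.add_one_sub_one, zero_add, mul_zero, Nat.reduceSub, RAB_comm A 1]
    ring
  · exact Finset.range_mono (by omega)
  · intro k _ hk
    rw [Polynomial.coeff_eq_zero_of_natDegree_lt (by simpa using hk), zero_mul]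

end Hermitian

/-- A Kähler algebraic curvature tensor is Bochner-flat iff it is of the form `R_{q,A}`
for a hermitian `A` and a quadratic polynomial `q`, iff it is of the form `R_{id,B}`
for a hermitian `B`. -/
theorem stmt19
    (V : Type*) [AddCommGroup V] [Module ℝ V] [FiniteDimensional ℝ V]
    (n : ℕ) (hn : 2 ≤ n) (hdim : Module.finrank ℝ V = 2 * n)
    (g : V →ₗ[ℝ] V →ₗ[ℝ] ℝ)
    (hgsymm : ∀ x y : V, g x y = g y x)
    (hgnd : ∀ x : V, (∀ y : V, g x y = 0) → x = 0)
    (J : Module.End ℝ V)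
    (hJ2 : J * J = -1)
    (hJg : ∀ x y : V, g (J x) (J y) = g x y)
    (Rend : V →ₗ[ℝ] V →ₗ[ℝ] V →ₗ[ℝ] V)
    (hK1 : ∀ x y u v : V, g x (Rend u v y) = -g y (Rend u v x))
    (hK1' : ∀ x y u v : V, g x (Rend u v y) = -g x (Rend v u y))
    (hK2 : ∀ x y u v : V, g x (Rend u v y) = g u (Rend x y v))
    (hK3 : ∀ x y u v : V,
      g x (Rend u v y) + g x (Rend y u v) + g x (Rend v y u) = 0)
    (hK4a : ∀ x y u v : V, g x (Rend u v y) = g (J x) (Rend u v (J y)))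
    (hK4b : ∀ x y u v : V, g x (Rend u v y) = g x (Rend (J u) (J v) y))
    (ricE : Module.End ℝ V)
    (hricE : ∀ x y : V, g x (ricE y) = ricci Rend x y) :
    let ω : V → V → ℝ := fun x y => g (J x) y
    let r : V → V → ℝ := fun x y => ricci Rend (J x) y
    let Scal : ℝ := LinearMap.trace ℝ V ricE
    let Boch : V → V → V → V → ℝ := fun x y u v =>
      g x (Rend u v y)
        - (1 / (2 * ((n : ℝ) + 2)))
          * (KN4 (fun a b => g a b) (ricci Rend) x y u v + KN4 ω r x y u v
              + 2 * SP4 ω r x y u v)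
        + (Scal / (8 * ((n : ℝ) + 1) * ((n : ℝ) + 2)))
          * (KN4 (fun a b => g a b) (fun a b => g a b) x y u v + KN4 ω ω x y u v
              + 2 * SP4 ω ω x y u v)
    ((∀ x y u v : V, Boch x y u v = 0) ↔
      (∃ (A : Module.End ℝ V) (q : Polynomial ℝ),
        (∀ x y : V, g (A x) y = g x (A y)) ∧ A * J = J * A ∧ q.natDegree ≤ 2 ∧
        ∀ x y u v : V, g x (Rend u v y) = RqA g J q A x y u v)) ∧
    ((∀ x y u v : V, Boch x y u v = 0) ↔
      (∃ B : Module.End ℝ V,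
        (∀ x y : V, g (B x) y = g x (B y)) ∧ B * J = J * B ∧
        ∀ x y u v : V, g x (Rend u v y) = RAB g J 1 B x y u v)) := by
  intro ω r Scal Boch
  have hJJ := complexStructure_apply_apply hJ2
  have hJs := complexStructure_skew hJ2 hJg
  have hn0 : (n : ℝ) + 1 ≠ 0 := by positivity
  have hn2 : (n : ℝ) + 2 ≠ 0 := by positivity
  have hsymm : ∀ x y, ricci Rend x y = ricci Rend y x := fun x y =>
    trace_eq_of_adjoint hgsymm hgnd fun w z => hK2 w y z x
  have hinv : ∀ x y, ricci Rend (J x) (J y) = ricci Rend x y := by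
    intro x y
    set T : Module.End ℝ V := (LinearMap.applyₗ y).comp ((LinearMap.applyₗ x).comp Rend) with hT
    have h1 : (LinearMap.applyₗ (J y)).comp ((LinearMap.applyₗ (J x)).comp Rend)
        = J * (T * (-J)) := by
      ext z
      refine eq_of_forall_apply_eq hgsymm hgnd fun w => ?_
      have h2 := hK4b w (J y) z (J x)
      have h3 := hK4a w (J y) (J z) (J (J x))
      simp only [hJJ, map_neg, LinearMap.neg_apply, neg_neg] at h2 h3
      simp only [hT, LinearMap.comp_apply, LinearMap.applyₗ_apply_apply, Module.End.mul_apply,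
        LinearMap.neg_apply, map_neg]
      rw [h2, h3, hJs]
    unfold ricci
    rw [h1, LinearMap.trace_mul_comm, mul_assoc, neg_mul, hJ2, neg_neg, mul_one]
  have hric : ∀ x y, g (ricE x) y = g x (ricE y) := fun x y => by
    rw [hgsymm, hricE, hricE, hsymm]
  have hricJ : ricE * J = J * ricE := by
    ext z
    refine eq_of_forall_apply_eq hgsymm hgnd fun w => ?_
    rw [Module.End.mul_apply, Module.End.mul_apply, hricE, ← hinv, hJJ, ← hricE, map_neg, map_neg, hJs,
      neg_neg]
  have hBoch : ∀ x y u v, Boch x y u v = g x (Rend u v y) - RAB g J 1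
      ((-Scal / (8 * ((n : ℝ) + 1) * ((n : ℝ) + 2))) • 1
        + (1 / (2 * ((n : ℝ) + 2))) • ricE) x y u v := by
    intro x y u v
    have hr : ∀ a b, ricci Rend a b = g (ricE a) b := fun a b => by rw [hric, hricE]
    have hc : ∀ a, ricE (J a) = J (ricE a) := fun a => LinearMap.congr_fun hricJ a
    rw [RAB_one_smul_one_add_smul]
    simp only [Boch, ω, r, RAB, KN4, SP4, hr, hc, Module.End.one_apply]
    ring
  have hiff : (∀ x y u v : V, Boch x y u v = 0) ↔ ∃ B : Module.End ℝ V,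
      (∀ x y : V, g (B x) y = g x (B y)) ∧ B * J = J * B ∧
        ∀ x y u v : V, g x (Rend u v y) = RAB g J 1 B x y u v := by
    constructor
    · intro h
      refine ⟨_, ?_, ?_, fun x y u v => sub_eq_zero.1 ((hBoch x y u v).symm.trans (h x y u v))⟩
      · intro x y
        simp [hric]
      · exact smul_one_add_smul_commute _ _ hricJ
    · rintro ⟨B, hB, hBJ, hR⟩ x y u v
      have hRic : ricE = LinearMap.trace ℝ V B • 1 + (2 * ((n : ℝ) + 2)) • B := by
        ext z
        refine eq_of_forall_apply_eq hgsymm hgnd fun w => ?_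
        rw [hricE, ricci, trace_of_eq_RAB_one hgsymm hgnd hJ2 hJg hB hBJ fun a b => hR a z b w,
          hdim]
        simp only [LinearMap.add_apply, LinearMap.smul_apply, Module.End.one_apply, map_add,
          map_smul, smul_eq_mul]
        push_cast
        ring
      have hScal : Scal = 4 * ((n : ℝ) + 1) * LinearMap.trace ℝ V B := by
        simp only [Scal]
        rw [hRic, map_add, map_smul, map_smul, LinearMap.trace_one, hdim, smul_eq_mul, smul_eq_mul]
        push_cast
        ring
      have hBe : (-Scal / (8 * ((n : ℝ) + 1) * ((n : ℝ) + 2))) • (1 : Module.End ℝ V)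
          + (1 / (2 * ((n : ℝ) + 2))) • ricE = B := by
        rw [hScal, hRic, smul_add, smul_smul, smul_smul, ← add_assoc, ← add_smul]
        have h1 : -(4 * ((n : ℝ) + 1) * LinearMap.trace ℝ V B) / (8 * ((n : ℝ) + 1) * ((n : ℝ) + 2))
            + 1 / (2 * ((n : ℝ) + 2)) * LinearMap.trace ℝ V B = 0 := by
          field_simp
          ring
        have h2 : 1 / (2 * ((n : ℝ) + 2)) * (2 * ((n : ℝ) + 2)) = 1 := by
          field_simp
        rw [h1, h2, zero_smul, one_smul, zero_add]
      rw [hBoch, hBe, hR, sub_self]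
  refine ⟨hiff.trans ⟨?_, ?_⟩, hiff⟩
  · rintro ⟨B, hB, hBJ, hR⟩
    refine ⟨(-4 : ℝ) • B, X ^ 2, ?_, ?_, (natDegree_X_pow 2).le, fun x y u v => ?_⟩
    · intro x y
      simp [hB]
    · rw [smul_mul_assoc, mul_smul_comm, hBJ]
    · rw [hR, RqA_of_natDegree_le_two (natDegree_X_pow 2).le]
      congr 1
      simp [coeff_X_pow, smul_smul]
  · rintro ⟨A, q, hA, hAJ, hq, hR⟩
    refine ⟨_, ?_, ?_, fun x y u v =>
      (hR x y u v).trans (RqA_of_natDegree_le_two hq A x y u v)⟩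
    · intro x y
      simp [hA]
    · exact smul_one_add_smul_commute _ _ hAJ
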